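/- Let (Γ_n) be a sequence of finite connected vertex-transitive graphs of diverging sizes n with uniformly bounded degree satisfying D² = o(n/log n), with f(n) defined by n = D²f(n). Fix k ≥ 1 and let t = t(n) satisfy t ≪ n. Then uniformly over sets A of vertices with |A| = k and over such t, E_π(T_A) = (t/P_π(T_A ≤ t))·(1 + O(n/(t·f(n))) + O(t/n)). -/

import Mathlib

open MeasureTheory Filter

noncomputable section

/-- Heat kernel (transition semigroup) of the continuous-time rate-1 Markov chain with
one-step transition matrix `K`, given by the uniformization formula
`p_t = e^{-t} ∑_k (t^k/k!) K^k`. -/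
def heatKer {V : Type} [Fintype V] [DecidableEq V] (K : Matrix V V ℝ) (t : ℝ) (x y : V) : ℝ :=
  ∑' k : ℕ, Real.exp (-t) * t ^ k / (Nat.factorial k : ℝ) * (K ^ k) x y

/-- A continuous-time Markov chain with jump matrix `K`: a family of path measures `P x`
(for the chain started at `x`), with right-continuous paths, whose finite-dimensional
distributions are given by the heat kernel of `K`. -/
structure CTMC (V : Type) [Fintype V] [DecidableEq V] (K : Matrix V V ℝ) where
  Ω : Type
  mΩ : MeasurableSpace Ω
  P : V → @Measure Ω mΩ
  prob : ∀ x, IsProbabilityMeasure (P x)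
  X : ℝ → Ω → V
  measX : ∀ (t : ℝ) (y : V), MeasurableSet[mΩ] {ω | X t ω = y}
  rightCts : ∀ (ω : Ω) (t : ℝ), ∃ ε > 0, ∀ s, t ≤ s → s < t + ε → X s ω = X t ω
  fdd : ∀ (x : V) (n : ℕ) (t : Fin (n + 1) → ℝ), Monotone t → t 0 = 0 →
    ∀ y : Fin (n + 1) → V,
      P x {ω | ∀ i, X (t i) ω = y i} =
        ENNReal.ofReal ((if y 0 = x then (1 : ℝ) else 0) *
          ∏ i : Fin n, heatKer K (t i.succ - t i.castSucc) (y i.castSucc) (y i.succ))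

namespace CTMC

variable {V : Type} [Fintype V] [DecidableEq V] {K : Matrix V V ℝ}

/-- Hitting time of a set of states. -/
def hit (W : CTMC V K) (A : Set V) (ω : W.Ω) : ℝ :=
  sInf {t : ℝ | 0 ≤ t ∧ W.X t ω ∈ A}

/-- Cover time: the first time every state has been visited. -/
def cov (W : CTMC V K) (ω : W.Ω) : ℝ :=
  sInf {t : ℝ | 0 ≤ t ∧ ∀ y : V, ∃ s, 0 ≤ s ∧ s ≤ t ∧ W.X s ω = y}

/-- The uncovered set at time `t`. -/
def uncov (W : CTMC V K) (t : ℝ) (ω : W.Ω) : Set V :=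
  {y | ∀ s, 0 ≤ s → s ≤ t → W.X s ω ≠ y}

/-- Local time at `y` up to time `t`. -/
def loc (W : CTMC V K) (y : V) (t : ℝ) (ω : W.Ω) : ℝ :=
  ∫ s in (0:ℝ)..t, (if W.X s ω = y then (1 : ℝ) else 0)

/-- Probability of an event for the walk started at `x`. -/
def prx (W : CTMC V K) (x : V) (S : Set W.Ω) : ℝ := (W.P x S).toReal

/-- Expectation of a path functional for the walk started at `x`. -/
def ex (W : CTMC V K) (x : V) (f : W.Ω → ℝ) : ℝ := ∫ ω, f ω ∂(W.P x)

/-- Probability of an event for the walk started from the uniform (stationary) distribution. -/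
def prpi (W : CTMC V K) (S : Set W.Ω) : ℝ :=
  (Fintype.card V : ℝ)⁻¹ * ∑ x : V, W.prx x S

/-- Expectation for the walk started from the uniform (stationary) distribution. -/
def epi (W : CTMC V K) (f : W.Ω → ℝ) : ℝ :=
  (Fintype.card V : ℝ)⁻¹ * ∑ x : V, W.ex x f

/-- Probability for the walk started from the initial distribution `a`. -/
def prw (W : CTMC V K) (a : V → ℝ) (S : Set W.Ω) : ℝ := ∑ x : V, a x * W.prx x S

/-- Expectation for the walk started from the initial distribution `a`. -/
def exw (W : CTMC V K) (a : V → ℝ) (f : W.Ω → ℝ) : ℝ := ∑ x : V, a x * W.ex x f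

end CTMC

/-- Total variation mixing time at level `1/4`. -/
def tmixTV {V : Type} [Fintype V] [DecidableEq V] (K : Matrix V V ℝ) : ℝ :=
  sInf {t : ℝ | 0 ≤ t ∧ ∀ x : V, ∑ y : V, |heatKer K t x y - (Fintype.card V : ℝ)⁻¹| ≤ 1 / 2}

/-- Transition matrix of the simple random walk on a graph. -/
def transMat {V : Type} [Fintype V] [DecidableEq V] (G : SimpleGraph V) [DecidableRel G.Adj] :
    Matrix V V ℝ :=
  Matrix.of fun x y => if G.Adj x y then ((G.degree x : ℝ))⁻¹ else 0

/-- Diameter of a finite graph. -/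
def gDiam {V : Type} [Fintype V] (G : SimpleGraph V) : ℕ :=
  Finset.univ.sup fun p : V × V => G.dist p.1 p.2

/-- Vertex-transitivity of a graph. -/
def IsVertexTransitive {V : Type} (G : SimpleGraph V) : Prop :=
  ∀ x y : V, ∃ φ : SimpleGraph.Iso G G, φ x = y

/-- A finite graph bundled together with a continuous-time rate-1 simple random walk on it. -/
structure GW where
  (V : Type) [fin : Fintype V] [deq : DecidableEq V]
  (G : SimpleGraph V) [adj : DecidableRel G.Adj]
  (W : CTMC V (transMat G))

instance (B : GW) : Fintype B.V := B.fin
instance (B : GW) : DecidableEq B.V := B.deq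
instance (B : GW) : DecidableRel B.G.Adj := B.adj
instance (B : GW) : MeasurableSpace B.W.Ω := B.W.mΩ

/-- Number of vertices. -/
def GW.nV (B : GW) : ℕ := Fintype.card B.V

/-- Diameter. -/
def GW.D (B : GW) : ℕ := gDiam B.G

/-- `f(n)`, defined by `n = D² f(n)`. -/
def GW.fgrowth (B : GW) : ℝ := (B.nV : ℝ) / (B.D : ℝ) ^ 2

/-- Standing assumptions: a sequence of finite connected vertex-transitive graphs with
degrees uniformly bounded by `d`, of diverging sizes, satisfying the diameter condition
`D² = o(n / log n)`. -/
def GoodSeq (B : ℕ → GW) (d : ℕ) : Prop :=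
  (∀ n, (B n).G.Connected) ∧
  (∀ n, IsVertexTransitive (B n).G) ∧
  (∀ n (x : (B n).V), (B n).G.degree x ≤ d) ∧
  Tendsto (fun n => (B n).nV) atTop atTop ∧
  Tendsto (fun n => ((B n).D : ℝ) ^ 2 * Real.log ((B n).nV) / ((B n).nV)) atTop (nhds 0)

/-- The transition matrix of the chain killed upon hitting `A`. -/
def killedMat {V : Type} [Fintype V] [DecidableEq V] (K : Matrix V V ℝ) (A : Finset V) :
    Matrix V V ℝ :=
  Matrix.of fun x y => if x ∈ A ∨ y ∈ A then 0 else K x y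

/-- `a` is the quasi-stationary distribution of `A` with rate `lam`: a probability
distribution supported off `A` which is a left eigenvector of the killed matrix for the
eigenvalue `1 - lam`, where `lam` is the smallest eigenvalue of `I_B - P_B`. -/
structure IsQSD {V : Type} [Fintype V] [DecidableEq V] (K : Matrix V V ℝ) (A : Finset V)
    (a : V → ℝ) (lam : ℝ) : Prop where
  nonneg : ∀ x, 0 ≤ a x
  sum_one : ∑ x : V, a x = 1
  supported : ∀ v ∈ A, a v = 0
  eigen : ∀ y : V, ∑ x : V, a x * killedMat K A x y = (1 - lam) * a y
  minimal : ∀ (mu : ℝ) (g : V → ℝ), g ≠ 0 → (∀ v ∈ A, g v = 0) →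
    (∀ y : V, ∑ x : V, g x * killedMat K A x y = (1 - mu) * g y) → lam ≤ mu

/-- Spectral gap `1 - λ₂` of a reversible transition matrix `K` with stationary
distribution `pd`. -/
def specGap {V : Type} [Fintype V] (K : Matrix V V ℝ) (pd : V → ℝ) : ℝ :=
  sInf {r : ℝ | ∃ g : V → ℝ, g ≠ 0 ∧ (∑ x : V, pd x * g x = 0) ∧
    ∀ y : V, ∑ x : V, K y x * g x = (1 - r) * g y}

/-- Relaxation time of a reversible chain. -/
def trel {V : Type} [Fintype V] (K : Matrix V V ℝ) (pd : V → ℝ) : ℝ := (specGap K pd)⁻¹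

/-- Total variation distance between two Borel measures on `ℝ`. -/
def dTVReal (μ ν : Measure ℝ) : ℝ :=
  ⨆ A : {A : Set ℝ // MeasurableSet A}, |(μ A.1).toReal - (ν A.1).toReal|

/-- The standard Gumbel distribution on `ℝ` (distribution function `s ↦ exp (-e^{-s})`). -/
def gumbelMeasure : Measure ℝ :=
  volume.withDensity fun s => ENNReal.ofReal (Real.exp (-s - Real.exp (-s)))

/-- `ψ(u) = (2/π²) ∑_{k ≥ 1} cos(2πku)/k²`. -/
def psiSeries (u : ℝ) : ℝ :=
  (2 / Real.pi ^ 2) * ∑' k : ℕ, Real.cos (2 * Real.pi * ((k : ℝ) + 1) * u) / ((k : ℝ) + 1) ^ 2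

/-- The cycle graph on `ℤ/mℤ`. -/
def cycleG (m : ℕ) : SimpleGraph (ZMod m) := SimpleGraph.fromRel fun x y => x - y = 1

instance (m : ℕ) : DecidableRel (cycleG m).Adj := fun _ _ => Classical.dec _

section Poincare

/-- A function into a seminormed group that varies by at most `s` along edges is
`s`-Lipschitz for the graph distance. -/
lemma norm_sub_le_dist_mul {V : Type} {G : SimpleGraph V} {E : Type*} [SeminormedAddCommGroup E]
    (hc : G.Connected) (F : V → E) (s : ℝ) (hs : ∀ u v, G.Adj u v → ‖F u - F v‖ ≤ s) (u v : V) :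
    ‖F u - F v‖ ≤ G.dist u v * s := by
  obtain ⟨p, hp⟩ := hc.exists_walk_length_eq_dist u v
  rw [← hp]
  clear hp
  induction p with
  | nil => simp
  | @cons a b c hab q ih =>
    have := norm_sub_le_norm_sub_add_norm_sub (F a) (F b) (F c)
    have := hs a b hab
    push_cast [SimpleGraph.Walk.length_cons]
    linarith

variable {V : Type} [Fintype V] {G : SimpleGraph V}

lemma dist_le_gDiam (x y : V) : G.dist x y ≤ gDiam G :=
  Finset.le_sup (f := fun p : V × V => G.dist p.1 p.2) (Finset.mem_univ (x, y))

/-- Averaging a function over the automorphism orbit of a vertex of a transitive graph. -/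
lemma card_mul_sum_iso [Fintype (G ≃g G)] (hG : IsVertexTransitive G) (h : V → ℝ) (u : V) :
    (Fintype.card V : ℝ) * ∑ φ : G ≃g G, h (φ u) = (Fintype.card (G ≃g G) : ℝ) * ∑ x, h x := by
  have hconst : ∀ x, ∑ φ : G ≃g G, h (φ x) = ∑ φ : G ≃g G, h (φ u) := by
    intro x
    obtain ⟨ψ, rfl⟩ := hG u x
    exact Fintype.sum_equiv (Equiv.mulRight ψ) _ _ fun φ => rfl
  calc (Fintype.card V : ℝ) * ∑ φ : G ≃g G, h (φ u)
      = ∑ x, ∑ φ : G ≃g G, h (φ x) := by simp [hconst]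
    _ = ∑ φ : G ≃g G, ∑ x, h (φ x) := Finset.sum_comm
    _ = ∑ _φ : G ≃g G, ∑ x, h x :=
        Finset.sum_congr rfl fun φ _ => Equiv.sum_comp φ.toEquiv h
    _ = _ := by simp

lemma degree_eq_of_isVertexTransitive [DecidableRel G.Adj] (hG : IsVertexTransitive G) (x y : V) :
    G.degree x = G.degree y := by
  obtain ⟨φ, rfl⟩ := hG x y
  exact (φ.degree_eq x).symm

/-- Poincaré inequality for a connected vertex-transitive graph. -/
lemma sum_sq_sub_le_gDiam [DecidableRel G.Adj] (hc : G.Connected) (hG : IsVertexTransitive G)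
    (f : V → ℝ) :
    ∑ x, ∑ y, (f x - f y) ^ 2 ≤
      Fintype.card V * (gDiam G : ℝ) ^ 2 *
        ∑ x, ∑ y, if G.Adj x y then (f x - f y) ^ 2 else 0 := by
  classical
  have : Finite (G ≃g G) := DFunLike.finite _
  have := Fintype.ofFinite (G ≃g G)
  obtain ⟨o⟩ := hc.nonempty
  set N : ℝ := ((Fintype.card V : ℕ) : ℝ)
  set M : ℝ := ((Fintype.card (G ≃g G) : ℕ) : ℝ)
  have hN : 0 < N := by
    have : Nonempty V := ⟨o⟩
    exact Nat.cast_pos.2 Fintype.card_pos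
  have hM : 0 < M := by
    have : Nonempty (G ≃g G) := ⟨1⟩
    exact Nat.cast_pos.2 Fintype.card_pos
  set e : V → ℝ := fun x => ∑ y, if G.Adj x y then (f x - f y) ^ 2 else 0
  have he : ∀ x y, G.Adj x y → (f x - f y) ^ 2 ≤ e x := by
    intro x y hxy
    have := Finset.single_le_sum (f := fun y => if G.Adj x y then (f x - f y) ^ 2 else 0)
      (fun z _ => by positivity) (Finset.mem_univ y)
    simpa [hxy] using this
  let F : V → EuclideanSpace ℝ (G ≃g G) := fun u => WithLp.toLp 2 fun φ => f (φ u)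
  have hF : ∀ u v, ‖F u - F v‖ ^ 2 = ∑ φ : G ≃g G, (f (φ u) - f (φ v)) ^ 2 := by
    intro u v
    simp [EuclideanSpace.norm_sq_eq, F]
  have hadj : ∀ u v, G.Adj u v → ‖F u - F v‖ ≤ √(M / N * ∑ x, e x) := by
    intro u v huv
    apply Real.le_sqrt_of_sq_le
    rw [hF, div_mul_eq_mul_div, le_div_iff₀ hN, mul_comm, ← card_mul_sum_iso hG e u]
    gcongr with φ
    exact he _ _ (φ.map_rel_iff.2 huv)
  have hpair : ∀ z, ∑ φ : G ≃g G, (f (φ o) - f (φ z)) ^ 2 ≤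
      (gDiam G : ℝ) ^ 2 * (M / N * ∑ x, e x) := by
    intro z
    have h0 : 0 ≤ ∑ x, e x := by positivity
    rw [← hF, ← Real.sq_sqrt (by positivity : 0 ≤ M / N * ∑ x, e x), ← mul_pow]
    gcongr
    refine (norm_sub_le_dist_mul hc F _ hadj o z).trans ?_
    gcongr
    exact dist_le_gDiam o z
  have hsum : M * ∑ x, ∑ y, (f x - f y) ^ 2 =
      N * ∑ z, ∑ φ : G ≃g G, (f (φ o) - f (φ z)) ^ 2 := by
    rw [← card_mul_sum_iso hG (fun x => ∑ y, (f x - f y) ^ 2) o,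
      Finset.sum_comm (f := fun z (φ : G ≃g G) => (f (φ o) - f (φ z)) ^ 2)]
    congr 1
    exact Finset.sum_congr rfl fun φ _ =>
      (Equiv.sum_comp φ.toEquiv fun y => (f (φ o) - f y) ^ 2).symm
  have hle : M * ∑ x, ∑ y, (f x - f y) ^ 2 ≤
      M * (N * (gDiam G : ℝ) ^ 2 * ∑ x, e x) := by
    rw [hsum]
    calc N * ∑ z, ∑ φ : G ≃g G, (f (φ o) - f (φ z)) ^ 2
        ≤ N * ∑ _z : V, (gDiam G : ℝ) ^ 2 * (M / N * ∑ x, e x) := by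
          gcongr with z
          exact hpair z
      _ = M * (N * (gDiam G : ℝ) ^ 2 * ∑ x, e x) := by
          simp only [Finset.sum_const, Finset.card_univ, nsmul_eq_mul]
          change N * (N * _) = _
          field_simp
  exact le_of_mul_le_mul_left hle hM

end Poincare

section TransMat

variable {V : Type} [Fintype V] [DecidableEq V] {G : SimpleGraph V} [DecidableRel G.Adj]

lemma transMat_nonneg (x y : V) : 0 ≤ transMat G x y := by
  simp only [transMat, Matrix.of_apply]
  positivity

lemma transMat_symm (hG : IsVertexTransitive G) (x y : V) :
    transMat G x y = transMat G y x := by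
  simp only [transMat, Matrix.of_apply, G.adj_comm x y, degree_eq_of_isVertexTransitive hG x y]

lemma transMat_row_sum (x : V) (hx : 0 < G.degree x) : ∑ y, transMat G x y = 1 := by
  have : (G.degree x : ℝ) ≠ 0 := by positivity
  simp only [transMat, Matrix.of_apply, ← Finset.sum_filter, Finset.sum_const, nsmul_eq_mul]
  rw [← SimpleGraph.neighborFinset_eq_filter, SimpleGraph.card_neighborFinset_eq_degree]
  field_simp

/-- Spectral form of the Poincaré inequality. -/
lemma variance_le_gDiam_sq (hc : G.Connected) (hG : IsVertexTransitive G) {d : ℕ}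
    (hd : ∀ x, G.degree x ≤ d) (hpos : ∀ x, 0 < G.degree x) (f : V → ℝ) :
    ∑ x, f x ^ 2 - (∑ x, f x) ^ 2 / Fintype.card V ≤
      d * (gDiam G : ℝ) ^ 2 * (∑ x, f x ^ 2 - ∑ x, ∑ y, f x * transMat G x y * f y) := by
  have hN : (0 : ℝ) < Fintype.card V := by
    have := hc.nonempty
    exact_mod_cast Fintype.card_pos
  have hexp : ∑ x, ∑ y, (f x - f y) ^ 2 =
      2 * Fintype.card V * (∑ x, f x ^ 2 - (∑ x, f x) ^ 2 / Fintype.card V) := by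
    have : ∑ x, ∑ y, (f x - f y) ^ 2 =
        ∑ x, ∑ y, (f x ^ 2 - 2 * (f x * f y) + f y ^ 2) := by
      refine Finset.sum_congr rfl fun x _ => Finset.sum_congr rfl fun y _ => ?_
      ring
    rw [this]
    simp only [Finset.sum_add_distrib, Finset.sum_sub_distrib, Finset.sum_const, ← Finset.mul_sum,
      ← Finset.sum_mul, Finset.card_univ, nsmul_eq_mul]
    field_simp
    ring
  have hdir : ∑ x, ∑ y, transMat G x y * (f x - f y) ^ 2 =
      2 * (∑ x, f x ^ 2 - ∑ x, ∑ y, f x * transMat G x y * f y) := by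
    have : ∑ x, ∑ y, transMat G x y * (f x - f y) ^ 2 =
        ∑ x, ∑ y, (transMat G x y * f x ^ 2 - 2 * (f x * transMat G x y * f y)
          + transMat G x y * f y ^ 2) := by
      refine Finset.sum_congr rfl fun x _ => Finset.sum_congr rfl fun y _ => ?_
      ring
    rw [this]
    simp only [Finset.sum_add_distrib, Finset.sum_sub_distrib, ← Finset.mul_sum]
    rw [Finset.sum_comm (f := fun x y => transMat G x y * f y ^ 2)]
    simp only [← Finset.sum_mul]
    have hcol : ∀ y, ∑ x, transMat G x y = 1 := fun y => by
      simp only [transMat_symm hG _ y, transMat_row_sum y (hpos y)]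
    simp only [hcol, transMat_row_sum _ (hpos _), one_mul]
    ring
  have hadj : ∑ x, ∑ y, (if G.Adj x y then (f x - f y) ^ 2 else 0) ≤
      d * ∑ x, ∑ y, transMat G x y * (f x - f y) ^ 2 := by
    simp only [Finset.mul_sum]
    gcongr with x _ y
    simp only [transMat, Matrix.of_apply]
    split_ifs
    · rw [← mul_assoc]
      apply le_mul_of_one_le_left (by positivity)
      have : (0 : ℝ) < G.degree x := by exact_mod_cast hpos x
      rw [← div_eq_mul_inv, one_le_div this]
      exact_mod_cast hd x
    · simp
  have h := sum_sq_sub_le_gDiam hc hG f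
  rw [hexp] at h
  rw [hdir] at hadj
  have h2 : 2 * Fintype.card V * (∑ x, f x ^ 2 - (∑ x, f x) ^ 2 / Fintype.card V) ≤
      2 * Fintype.card V * (d * (gDiam G : ℝ) ^ 2 *
        (∑ x, f x ^ 2 - ∑ x, ∑ y, f x * transMat G x y * f y)) := by
    refine h.trans ?_
    refine (mul_le_mul_of_nonneg_left hadj (by positivity)).trans_eq ?_
    ring
  exact le_of_mul_le_mul_left h2 (by positivity)

end TransMat

section Spectral

variable {V : Type} [Fintype V] [DecidableEq V]

/-- `M = ∑ i, μ i • v i ⊗ v i` with `v` an orthonormal basis. -/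
structure IsSpectralDecomp (M : Matrix V V ℝ) (μ : V → ℝ) (v : V → V → ℝ) : Prop where
  orth : ∀ i j, ∑ x, v i x * v j x = if i = j then 1 else 0
  complete : ∀ x y, ∑ i, v i x * v i y = if x = y then 1 else 0
  apply_eq : ∀ x y, M x y = ∑ i, μ i * (v i x * v i y)

lemma exists_isSpectralDecomp (M : Matrix V V ℝ) (hM : ∀ x y, M x y = M y x) :
    ∃ μ v, IsSpectralDecomp M μ v := by
  have hH : M.IsHermitian := Matrix.IsHermitian.ext fun x y => by simp [hM x y]
  have hcomp : ∀ x y, ∑ i, hH.eigenvectorBasis i x * hH.eigenvectorBasis i y =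
      if x = y then 1 else 0 := by
    intro x y
    have := congrFun (congrFun (Unitary.coe_mul_star_self hH.eigenvectorUnitary) x) y
    simpa [Matrix.mul_apply, Matrix.one_apply, Matrix.star_apply] using this
  refine ⟨hH.eigenvalues, fun i x => hH.eigenvectorBasis i x, ?_, hcomp, ?_⟩
  · intro i j
    have := congrFun (congrFun (Unitary.coe_star_mul_self hH.eigenvectorUnitary) i) j
    simpa [Matrix.mul_apply, Matrix.one_apply, Matrix.star_apply] using this
  · intro x y
    calc M x y = ∑ z, M x z * if z = y then 1 else 0 := by simp
      _ = ∑ z, M x z * ∑ i, hH.eigenvectorBasis i z * hH.eigenvectorBasis i y := by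
          simp only [hcomp]
      _ = ∑ i, (∑ z, M x z * hH.eigenvectorBasis i z) * hH.eigenvectorBasis i y := by
          simp only [Finset.mul_sum, Finset.sum_mul]
          rw [Finset.sum_comm]
          simp only [mul_assoc]
      _ = _ := by
          refine Finset.sum_congr rfl fun i _ => ?_
          have := congrFun (hH.mulVec_eigenvectorBasis i) x
          simp only [Matrix.mulVec, dotProduct, Pi.smul_apply, smul_eq_mul] at this
          rw [this, mul_assoc]

namespace IsSpectralDecomp

variable {M : Matrix V V ℝ} {μ : V → ℝ} {v : V → V → ℝ}

lemma sum_mul_apply (h : IsSpectralDecomp M μ v) (i : V) (x : V) :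
    ∑ y, M x y * v i y = μ i * v i x := by
  calc ∑ y, M x y * v i y = ∑ j, μ j * v j x * ∑ y, v j y * v i y := by
        simp only [h.apply_eq, Finset.sum_mul, Finset.mul_sum]
        rw [Finset.sum_comm]
        refine Finset.sum_congr rfl fun j _ => Finset.sum_congr rfl fun y _ => ?_
        ring
    _ = μ i * v i x := by simp [h.orth]

lemma pow_apply (h : IsSpectralDecomp M μ v) (k : ℕ) (x y : V) :
    (M ^ k) x y = ∑ i, μ i ^ k * (v i x * v i y) := by
  induction k generalizing x with
  | zero => simp [h.complete, Matrix.one_apply]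
  | succ k ih =>
    rw [pow_succ', Matrix.mul_apply]
    simp only [ih, Finset.mul_sum]
    rw [Finset.sum_comm]
    refine Finset.sum_congr rfl fun i _ => ?_
    calc ∑ z, M x z * (μ i ^ k * (v i z * v i y))
        = μ i ^ k * v i y * ∑ z, M x z * v i z := by
          rw [Finset.mul_sum]
          exact Finset.sum_congr rfl fun z _ => by ring
      _ = _ := by rw [h.sum_mul_apply]; ring

lemma hasSum_heatKer (h : IsSpectralDecomp M μ v) (t : ℝ) (x y : V) :
    HasSum (fun k : ℕ => Real.exp (-t) * t ^ k / (Nat.factorial k : ℝ) * (M ^ k) x y)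
      (∑ i, Real.exp (-(1 - μ i) * t) * (v i x * v i y)) := by
  have h1 : ∀ i, HasSum (fun k : ℕ => Real.exp (-t) * t ^ k / (Nat.factorial k : ℝ) *
      (μ i ^ k * (v i x * v i y))) (Real.exp (-(1 - μ i) * t) * (v i x * v i y)) := by
    intro i
    have := ((NormedSpace.expSeries_div_hasSum_exp (t * μ i)).mul_left
      (Real.exp (-t))).mul_right (v i x * v i y)
    rw [← Real.exp_eq_exp_ℝ, ← Real.exp_add] at this
    rw [show -(1 - μ i) * t = -t + t * μ i by ring]
    rwa [show (fun k : ℕ => Real.exp (-t) * t ^ k / (Nat.factorial k : ℝ) *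
      (μ i ^ k * (v i x * v i y))) = fun k : ℕ => Real.exp (-t) *
        ((t * μ i) ^ k / (Nat.factorial k : ℝ)) * (v i x * v i y) from
      funext fun k => by rw [mul_pow]; ring]
  convert hasSum_sum fun i (_ : i ∈ Finset.univ) => h1 i using 1
  funext k
  rw [h.pow_apply, Finset.mul_sum]

lemma heatKer_eq (h : IsSpectralDecomp M μ v) (t : ℝ) (x y : V) :
    heatKer M t x y = ∑ i, Real.exp (-(1 - μ i) * t) * (v i x * v i y) :=
  (h.hasSum_heatKer t x y).tsum_eq

end IsSpectralDecomp

variable {K M : Matrix V V ℝ} {A : Finset V}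

lemma hasSum_heatKer (hM : ∀ x y, M x y = M y x) (t : ℝ) (x y : V) :
    HasSum (fun k : ℕ => Real.exp (-t) * t ^ k / (Nat.factorial k : ℝ) * (M ^ k) x y)
      (heatKer M t x y) := by
  obtain ⟨μ, v, h⟩ := exists_isSpectralDecomp M hM
  rw [h.heatKer_eq]
  exact h.hasSum_heatKer t x y

lemma heatKer_add (hM : ∀ x y, M x y = M y x) (s t : ℝ) (x y : V) :
    ∑ z, heatKer M s x z * heatKer M t z y = heatKer M (s + t) x y := by
  obtain ⟨μ, v, h⟩ := exists_isSpectralDecomp M hM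
  simp only [h.heatKer_eq]
  calc _ = ∑ i, ∑ j, Real.exp (-(1 - μ i) * s) * v i x * (Real.exp (-(1 - μ j) * t) * v j y) *
        ∑ z, v i z * v j z := by
        simp_rw [Finset.sum_mul_sum, Finset.mul_sum]
        rw [Finset.sum_comm]
        refine Finset.sum_congr rfl fun i _ => ?_
        rw [Finset.sum_comm]
        refine Finset.sum_congr rfl fun j _ => Finset.sum_congr rfl fun z _ => ?_
        ring
    _ = _ := by
        simp only [h.orth, mul_ite, mul_one, mul_zero, Finset.sum_ite_eq, Finset.mem_univ, if_true]
        refine Finset.sum_congr rfl fun i _ => ?_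
        rw [mul_add, Real.exp_add]
        ring

lemma hasSum_poisson (t : ℝ) :
    HasSum (fun k : ℕ => Real.exp (-t) * t ^ k / (Nat.factorial k : ℝ)) 1 := by
  have := (NormedSpace.expSeries_div_hasSum_exp t).mul_left (Real.exp (-t))
  rw [← Real.exp_eq_exp_ℝ, ← Real.exp_add, neg_add_cancel, Real.exp_zero] at this
  simpa only [mul_div_assoc] using this

lemma pow_nonneg_apply (hM : ∀ x y, 0 ≤ M x y) (k : ℕ) (x y : V) : 0 ≤ (M ^ k) x y := by
  induction k generalizing x with
  | zero => rw [pow_zero, Matrix.one_apply]; positivity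
  | succ k ih =>
    rw [pow_succ', Matrix.mul_apply]
    exact Finset.sum_nonneg fun z _ => mul_nonneg (hM x z) (ih z)

lemma pow_row_sum (hM : ∀ x, ∑ y, M x y = 1) (k : ℕ) (x : V) : ∑ y, (M ^ k) x y = 1 := by
  induction k generalizing x with
  | zero => simp [Matrix.one_apply]
  | succ k ih =>
    simp only [pow_succ', Matrix.mul_apply]
    rw [Finset.sum_comm]
    simp only [← Finset.mul_sum, ih, mul_one, hM]

lemma heatKer_nonneg (hM : ∀ x y, 0 ≤ M x y) {t : ℝ} (ht : 0 ≤ t) (x y : V) :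
    0 ≤ heatKer M t x y :=
  tsum_nonneg fun k => mul_nonneg (by positivity) (pow_nonneg_apply hM k x y)

lemma heatKer_row_sum (hs : ∀ x y, M x y = M y x) (hM : ∀ x, ∑ y, M x y = 1) (t : ℝ) (x : V) :
    ∑ y, heatKer M t x y = 1 := by
  have := hasSum_sum fun y (_ : y ∈ Finset.univ) => hasSum_heatKer hs t x y
  simp only [← Finset.mul_sum, pow_row_sum hM, mul_one] at this
  exact this.unique (hasSum_poisson t)

lemma killedMat_nonneg (hK : ∀ x y, 0 ≤ K x y) (x y : V) : 0 ≤ killedMat K A x y := by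
  simp only [killedMat, Matrix.of_apply]
  split_ifs
  exacts [le_rfl, hK x y]

lemma killedMat_symm (hK : ∀ x y, K x y = K y x) (x y : V) :
    killedMat K A x y = killedMat K A y x := by
  simp only [killedMat, Matrix.of_apply, or_comm (a := x ∈ A), hK x y]

lemma killedMat_le (hK : ∀ x y, 0 ≤ K x y) (x y : V) : killedMat K A x y ≤ K x y := by
  simp only [killedMat, Matrix.of_apply]
  split_ifs
  exacts [hK x y, le_rfl]

lemma killedMat_pow_le (hK : ∀ x y, 0 ≤ K x y) (k : ℕ) (x y : V) :
    (killedMat K A ^ k) x y ≤ (K ^ k) x y := by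
  induction k generalizing x with
  | zero => simp
  | succ k ih =>
    simp only [pow_succ', Matrix.mul_apply]
    gcongr with z
    · exact pow_nonneg_apply (killedMat_nonneg hK) k z y
    · exact hK x z
    · exact killedMat_le hK x z
    · exact ih z

lemma killedMat_pow_eq_zero {x y : V} (hx : x ∈ A) (hy : y ∉ A) (k : ℕ) :
    (killedMat K A ^ k) x y = 0 := by
  cases k with
  | zero => simp [ne_of_mem_of_not_mem hx hy]
  | succ k => simp [pow_succ', Matrix.mul_apply, killedMat, hx]

/-- Survival probability up to time `t` of the chain with jump matrix `K` killed on `A`. -/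
def surv (K : Matrix V V ℝ) (A : Finset V) (t : ℝ) (x : V) : ℝ :=
  ∑ y ∈ Aᶜ, heatKer (killedMat K A) t x y

lemma surv_of_mem {x : V} (hx : x ∈ A) (t : ℝ) : surv K A t x = 0 := by
  refine Finset.sum_eq_zero fun y hy => ?_
  simp [heatKer, killedMat_pow_eq_zero hx (Finset.mem_compl.1 hy)]

lemma surv_nonneg (hK : ∀ x y, 0 ≤ K x y) {t : ℝ} (ht : 0 ≤ t) (x : V) : 0 ≤ surv K A t x :=
  Finset.sum_nonneg fun y _ => heatKer_nonneg (killedMat_nonneg hK) ht x y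

lemma surv_zero {x : V} (hx : x ∉ A) : surv K A 0 x = 1 := by
  have : ∀ y, heatKer (killedMat K A) 0 x y = if x = y then 1 else 0 := by
    intro y
    rw [heatKer, tsum_eq_single 0 fun k hk => by simp [hk]]
    simp [Matrix.one_apply]
  simp [surv, this, hx]

lemma sum_heatKer_mul_surv (hs : ∀ x y, K x y = K y x) (s t : ℝ) (x : V) :
    ∑ z ∈ Aᶜ, heatKer (killedMat K A) s x z * surv K A t z = surv K A (s + t) x := by
  have h : ∑ z ∈ Aᶜ, heatKer (killedMat K A) s x z * surv K A t z =
      ∑ z, heatKer (killedMat K A) s x z * surv K A t z := by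
    refine Finset.sum_subset (Finset.subset_univ _) fun z _ hz => ?_
    rw [surv_of_mem (by simpa using hz), mul_zero]
  rw [h]
  simp only [surv, Finset.mul_sum]
  rw [Finset.sum_comm]
  exact Finset.sum_congr rfl fun y _ => heatKer_add (killedMat_symm hs) s t x y

lemma heatKer_killedMat_le (hK : ∀ x y, 0 ≤ K x y) (hs : ∀ x y, K x y = K y x) {t : ℝ}
    (ht : 0 ≤ t) (x y : V) : heatKer (killedMat K A) t x y ≤ heatKer K t x y := by
  refine hasSum_le (fun k => ?_) (hasSum_heatKer (killedMat_symm hs) t x y)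
    (hasSum_heatKer hs t x y)
  gcongr
  exact killedMat_pow_le hK k x y

lemma surv_le_one (hK : ∀ x y, 0 ≤ K x y) (hs : ∀ x y, K x y = K y x)
    (h1 : ∀ x, ∑ y, K x y = 1) {t : ℝ} (ht : 0 ≤ t) (x : V) : surv K A t x ≤ 1 := by
  rw [← heatKer_row_sum hs h1 t x]
  calc surv K A t x ≤ ∑ y ∈ Aᶜ, heatKer K t x y :=
        Finset.sum_le_sum fun y _ => heatKer_killedMat_le hK hs ht x y
    _ ≤ _ := Finset.sum_le_sum_of_subset_of_nonneg (Finset.subset_univ _)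
        fun y _ _ => heatKer_nonneg hK ht x y

/-- Over a short time `t`, killing on `A` only at time `t` rather than continuously
changes the survival probability by at most `t ^ 2`. -/
lemma sum_heatKer_sub_le (hK : ∀ x y, 0 ≤ K x y) (hs : ∀ x y, K x y = K y x)
    (h1 : ∀ x, ∑ y, K x y = 1) {t : ℝ} (ht : 0 ≤ t) {x : V} (hx : x ∉ A) :
    ∑ y ∈ Aᶜ, (heatKer K t x y - heatKer (killedMat K A) t x y) ≤ t ^ 2 := by
  have hsum := hasSum_sum fun y (_ : y ∈ Aᶜ) =>
    (hasSum_heatKer hs t x y).sub (hasSum_heatKer (killedMat_symm (A := A) hs) t x y)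
  simp only [← mul_sub, ← Finset.mul_sum] at hsum
  have hbd := (hasSum_poisson t).sub (hasSum_sum_of_ne_finset_zero
    (f := fun k : ℕ => if k < 2 then Real.exp (-t) * t ^ k / (Nat.factorial k : ℝ) else 0)
    (s := Finset.range 2) (fun k hk => if_neg (by simpa using hk)))
  have hle := hasSum_le (fun k => ?_) hsum hbd
  · refine hle.trans ?_
    simp only [Finset.sum_range_succ, Finset.sum_range_zero]
    norm_num
    nlinarith [Real.add_one_le_exp (-t), mul_nonneg ht ht]
  · split_ifs with hk
    · rw [sub_self]
      refine (mul_eq_zero_of_right _ (Finset.sum_eq_zero fun y hy => ?_)).le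
      have hy' := Finset.mem_compl.1 hy
      interval_cases k
      · simp
      · simp [killedMat, hx, hy']
    · rw [sub_zero]
      refine mul_le_of_le_one_right (by positivity) ?_
      rw [← pow_row_sum h1 k x]
      calc ∑ y ∈ Aᶜ, ((K ^ k) x y - (killedMat K A ^ k) x y) ≤ ∑ y ∈ Aᶜ, (K ^ k) x y := by
            gcongr with y
            linarith [pow_nonneg_apply (killedMat_nonneg (A := A) hK) k x y]
        _ ≤ _ := Finset.sum_le_sum_of_subset_of_nonneg (Finset.subset_univ _)
          fun y _ _ => pow_nonneg_apply hK k x y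

/-- Exponential approximation of the survival probability started from stationarity, under a
Poincaré inequality with constant `τ`. -/
lemma exists_rate (hK : ∀ x y, 0 ≤ K x y) (hs : ∀ x y, K x y = K y x)
    (h1 : ∀ x, ∑ y, K x y = 1) {τ : ℝ} (hτ : 0 ≤ τ)
    (hP : ∀ f : V → ℝ, ∑ x, f x ^ 2 - (∑ x, f x) ^ 2 / Fintype.card V ≤
      τ * (∑ x, f x ^ 2 - ∑ x, ∑ y, f x * K x y * f y))
    (hA : 0 < A.card) (hcard : 2 * A.card < Fintype.card V) :
    ∃ r : ℝ, 0 < r ∧ r ≤ 2 * A.card / Fintype.card V ∧ ∀ t, 0 ≤ t →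
      (1 - r * τ) * Real.exp (-r * t) ≤ (Fintype.card V : ℝ)⁻¹ * ∑ x, surv K A t x ∧
      (Fintype.card V : ℝ)⁻¹ * ∑ x, surv K A t x ≤ Real.exp (-r * t) := by
  obtain ⟨μ, v, h⟩ := exists_isSpectralDecomp (killedMat K A) (killedMat_symm hs)
  set n : ℝ := ((Fintype.card V : ℕ) : ℝ) with hn_def
  set k : ℝ := ((A.card : ℕ) : ℝ) with hk_def
  have hk0 : 0 < k := Nat.cast_pos.2 hA
  have hkn : 2 * k < n := by
    rw [hk_def, hn_def]
    exact_mod_cast hcard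
  have hn0 : 0 < n := by linarith
  have hcompl : ((Aᶜ.card : ℕ) : ℝ) = n - k := by
    rw [Finset.card_compl, Nat.cast_sub (Finset.card_le_univ A)]
  have hne : Nonempty V := Fintype.card_pos_iff.1 (by omega)
  obtain ⟨i₀, -, hmax⟩ := Finset.exists_max_image Finset.univ μ Finset.univ_nonempty
  replace hmax := fun i => hmax i (Finset.mem_univ i)
  set c : V → ℝ := fun i => ∑ x ∈ Aᶜ, v i x
  have hbil : ∀ a : V → ℝ, ∑ x ∈ Aᶜ, ∑ y ∈ Aᶜ, ∑ i, a i * (v i x * v i y) =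
      ∑ i, a i * c i ^ 2 := by
    intro a
    simp_rw [c, sq, Finset.sum_mul_sum, Finset.mul_sum]
    rw [Finset.sum_comm (s := Finset.univ)]
    exact Finset.sum_congr rfl fun x _ => Finset.sum_comm
  have hc : ∑ i, c i ^ 2 = n - k := by
    have := hbil fun _ => 1
    simp only [one_mul, h.complete, Finset.sum_ite_eq] at this
    rw [← this, ← hcompl, Finset.sum_ite_mem, Finset.inter_self]
    simp
  have hquad : ∑ x ∈ Aᶜ, ∑ y ∈ Aᶜ, K x y = ∑ i, μ i * c i ^ 2 := by
    rw [← hbil]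
    refine Finset.sum_congr rfl fun x hx => Finset.sum_congr rfl fun y hy => ?_
    rw [Finset.mem_compl] at hx hy
    rw [← h.apply_eq]
    simp [killedMat, hx, hy]
  have hKlow : n - 2 * k ≤ ∑ x ∈ Aᶜ, ∑ y ∈ Aᶜ, K x y := by
    have e1 : ∀ x, ∑ y ∈ Aᶜ, K x y = 1 - ∑ y ∈ A, K x y := fun x => by
      rw [← h1 x, ← Finset.sum_add_sum_compl A]; ring
    have e2 : ∑ x ∈ Aᶜ, ∑ y ∈ A, K x y ≤ k := by
      calc ∑ x ∈ Aᶜ, ∑ y ∈ A, K x y = ∑ y ∈ A, ∑ x ∈ Aᶜ, K x y := Finset.sum_comm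
        _ ≤ ∑ _y ∈ A, (1 : ℝ) := by
            gcongr with y
            rw [← h1 y]
            simp only [hs _ y]
            exact Finset.sum_le_sum_of_subset_of_nonneg (Finset.subset_univ _)
              fun z _ _ => hK y z
        _ = k := by simp [hk_def]
    simp only [e1, Finset.sum_sub_distrib, Finset.sum_const, nsmul_eq_mul, mul_one, hcompl]
    linarith
  have hμlow : n - 2 * k ≤ μ i₀ * (n - k) := by
    refine hKlow.trans ?_
    rw [hquad, ← hc, Finset.mul_sum]
    gcongr with i
    exact hmax i
  have hμpos : 0 < μ i₀ := by
    by_contra hneg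
    nlinarith
  have hvA : ∀ x ∈ A, v i₀ x = 0 := by
    intro x hx
    have := h.sum_mul_apply i₀ x
    simp only [killedMat, Matrix.of_apply, hx, true_or, if_true, zero_mul,
      Finset.sum_const_zero] at this
    exact (mul_eq_zero.1 this.symm).resolve_left hμpos.ne'
  have hnorm : ∑ x, v i₀ x ^ 2 = 1 := by
    simpa [sq] using h.orth i₀ i₀
  have hKv : ∑ x, ∑ y, v i₀ x * K x y * v i₀ y = μ i₀ := by
    calc ∑ x, ∑ y, v i₀ x * K x y * v i₀ y
        = ∑ x, v i₀ x * ∑ y, killedMat K A x y * v i₀ y := by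
          simp only [Finset.mul_sum]
          refine Finset.sum_congr rfl fun x _ => Finset.sum_congr rfl fun y _ => ?_
          by_cases hx : x ∈ A
          · simp [hvA x hx]
          by_cases hy : y ∈ A
          · simp [hvA y hy]
          simp [killedMat, hx, hy, mul_assoc]
      _ = μ i₀ * ∑ x, v i₀ x ^ 2 := by
          rw [Finset.mul_sum]
          refine Finset.sum_congr rfl fun x _ => ?_
          rw [h.sum_mul_apply]
          ring
      _ = μ i₀ := by rw [hnorm, mul_one]
  have hcv : ∑ x, v i₀ x = c i₀ := by
    refine (Finset.sum_subset (Finset.subset_univ _) fun x _ hx => hvA x ?_).symm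
    simpa using hx
  have hgap : 1 - c i₀ ^ 2 / n ≤ τ * (1 - μ i₀) := by
    have := hP (v i₀)
    rwa [hnorm, hcv, hKv] at this
  have hsurv : ∀ t, ∑ x, surv K A t x = ∑ i, Real.exp (-(1 - μ i) * t) * c i ^ 2 := by
    intro t
    calc ∑ x, surv K A t x = ∑ x ∈ Aᶜ, surv K A t x :=
          (Finset.sum_subset (Finset.subset_univ _) fun x _ hx =>
            surv_of_mem (by simpa using hx) t).symm
      _ = _ := by
          rw [← hbil]
          simp only [surv, h.heatKer_eq]
  have hcle : c i₀ ^ 2 ≤ n - k := by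
    rw [← hc]
    exact Finset.single_le_sum (f := fun i => c i ^ 2) (fun i _ => sq_nonneg _)
      (Finset.mem_univ i₀)
  refine ⟨1 - μ i₀, ?_, ?_, fun t ht => ⟨?_, ?_⟩⟩
  · have : k / n ≤ τ * (1 - μ i₀) := by
      refine le_trans ?_ hgap
      rw [div_le_iff₀ hn0, sub_mul, div_mul_cancel₀ _ hn0.ne']
      linarith
    exact pos_of_mul_pos_right (lt_of_lt_of_le (by positivity) this) hτ
  · rw [le_div_iff₀ hn0]
    nlinarith
  · rw [hsurv, inv_mul_eq_div, le_div_iff₀ hn0]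
    calc (1 - (1 - μ i₀) * τ) * Real.exp (-(1 - μ i₀) * t) * n
        ≤ (c i₀ ^ 2 / n) * Real.exp (-(1 - μ i₀) * t) * n := by
          gcongr
          linarith
      _ = Real.exp (-(1 - μ i₀) * t) * c i₀ ^ 2 := by field_simp
      _ ≤ _ := Finset.single_le_sum
          (f := fun i => Real.exp (-(1 - μ i) * t) * c i ^ 2)
          (fun i _ => by positivity) (Finset.mem_univ i₀)
  · rw [hsurv, inv_mul_eq_div, div_le_iff₀ hn0]
    calc ∑ i, Real.exp (-(1 - μ i) * t) * c i ^ 2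
        ≤ ∑ i, Real.exp (-(1 - μ i₀) * t) * c i ^ 2 := by
          gcongr with i
          exact hmax i
      _ = Real.exp (-(1 - μ i₀) * t) * (n - k) := by rw [← Finset.mul_sum, hc]
      _ ≤ _ := by gcongr; linarith

end Spectral

section Grid

variable {V : Type} [Fintype V] [DecidableEq V]

/-- Probability that the chain with jump matrix `K` is off `A` at the times
`0, δ, 2δ, …, N δ`. -/
def gridSurv (K : Matrix V V ℝ) (A : Finset V) (δ : ℝ) : ℕ → V → ℝ
  | 0, x => if x ∈ A then 0 else 1
  | N + 1, x => if x ∈ A then 0 else ∑ z ∈ Aᶜ, heatKer K δ x z * gridSurv K A δ N z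

variable {K : Matrix V V ℝ} {A : Finset V}

lemma gridSurv_of_mem {x : V} (hx : x ∈ A) (δ : ℝ) (N : ℕ) : gridSurv K A δ N x = 0 := by
  cases N <;> simp [gridSurv, hx]

lemma sum_paths_eq_gridSurv (δ : ℝ) (N : ℕ) (x : V) :
    ∑ y : Fin (N + 1) → V, ((if y 0 = x then (1 : ℝ) else 0) *
      ∏ i : Fin N, heatKer K δ (y i.castSucc) (y i.succ)) *
        ∏ i, (if y i ∈ A then (0 : ℝ) else 1) = gridSurv K A δ N x := by
  induction N generalizing x with
  | zero =>
    rw [← Equiv.sum_comp (Equiv.funUnique (Fin 1) V).symm]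
    simp only [gridSurv, Equiv.funUnique_symm_apply, uniqueElim_const, Finset.univ_eq_empty,
      Finset.prod_empty, mul_one]
    rw [Finset.sum_eq_single x (fun z _ hz => by simp [hz]) (by simp)]
    simp
  | succ N ih =>
    have hS : gridSurv K A δ (N + 1) x =
        if x ∈ A then 0 else ∑ z, heatKer K δ x z * gridSurv K A δ N z := by
      rw [gridSurv]
      congr 1
      refine Finset.sum_subset (Finset.subset_univ _) fun z _ hz => ?_
      rw [gridSurv_of_mem (by simpa using hz), mul_zero]
    rw [hS, ← Equiv.sum_comp (Fin.consEquiv fun _ => V), Fintype.sum_prod_type]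
    simp only [Fin.consEquiv, Equiv.coe_fn_mk, Fin.cons_zero, Fin.prod_univ_succ (n := N),
      Fin.prod_univ_succ (n := N + 1), Fin.castSucc_zero, Fin.cons_succ, ← Fin.succ_castSucc]
    rw [Finset.sum_eq_single x (fun a _ ha => by simp [ha]) (by simp)]
    by_cases hx : x ∈ A
    · simp [hx]
    · simp only [hx, if_true, if_false, one_mul, ← ih, Finset.mul_sum]
      rw [Finset.sum_comm]
      refine Finset.sum_congr rfl fun y _ => ?_
      rw [Finset.sum_eq_single (y 0) (fun z _ hz => by simp [hz.symm]) (by simp)]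
      simp only [if_true, one_mul]
      rw [Fin.prod_univ_succ (n := N)]
      ring

lemma surv_le_gridSurv (hK : ∀ x y, 0 ≤ K x y) (hs : ∀ x y, K x y = K y x) {δ : ℝ} (hδ : 0 ≤ δ)
    (N : ℕ) (x : V) : surv K A (N * δ) x ≤ gridSurv K A δ N x := by
  by_cases hx : x ∈ A
  · rw [surv_of_mem hx, gridSurv_of_mem hx]
  induction N generalizing x with
  | zero => simp [gridSurv, surv_zero hx, hx]
  | succ N ih =>
    rw [gridSurv, if_neg hx, show ((N + 1 : ℕ) : ℝ) * δ = δ + N * δ by push_cast; ring,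
      ← sum_heatKer_mul_surv hs]
    refine Finset.sum_le_sum fun z hz => ?_
    exact mul_le_mul (heatKer_killedMat_le hK hs hδ x z) (ih z (Finset.mem_compl.1 hz))
      (surv_nonneg hK (by positivity) z) (heatKer_nonneg hK hδ x z)

lemma gridSurv_le_surv_add (hK : ∀ x y, 0 ≤ K x y) (hs : ∀ x y, K x y = K y x)
    (h1 : ∀ x, ∑ y, K x y = 1) {δ : ℝ} (hδ : 0 ≤ δ) (N : ℕ) (x : V) :
    gridSurv K A δ N x ≤ surv K A (N * δ) x + N * δ ^ 2 := by
  by_cases hx : x ∈ A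
  · rw [surv_of_mem hx, gridSurv_of_mem hx]
    positivity
  induction N generalizing x with
  | zero => simp [gridSurv, surv_zero hx, hx]
  | succ N ih =>
    rw [gridSurv, if_neg hx, show ((N + 1 : ℕ) : ℝ) * δ = δ + N * δ by push_cast; ring,
      ← sum_heatKer_mul_surv hs]
    have hrow : ∑ z ∈ Aᶜ, heatKer K δ x z ≤ 1 := by
      rw [← heatKer_row_sum hs h1 δ x]
      exact Finset.sum_le_sum_of_subset_of_nonneg (Finset.subset_univ _)
        fun z _ _ => heatKer_nonneg hK hδ x z
    calc ∑ z ∈ Aᶜ, heatKer K δ x z * gridSurv K A δ N z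
        ≤ ∑ z ∈ Aᶜ, (heatKer (killedMat K A) δ x z * surv K A (N * δ) z +
            ((heatKer K δ x z - heatKer (killedMat K A) δ x z) +
              heatKer K δ x z * (N * δ ^ 2))) := by
          refine Finset.sum_le_sum fun z hz => ?_
          have h2 := mul_le_mul_of_nonneg_left (ih z (Finset.mem_compl.1 hz))
            (heatKer_nonneg hK hδ x z)
          have h3 := mul_le_mul_of_nonneg_left
            (surv_le_one (A := A) hK hs h1 (by positivity : 0 ≤ N * δ) z)
            (sub_nonneg.2 (heatKer_killedMat_le (A := A) hK hs hδ x z))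
          linarith
      _ = ∑ z ∈ Aᶜ, heatKer (killedMat K A) δ x z * surv K A (N * δ) z +
            (∑ z ∈ Aᶜ, (heatKer K δ x z - heatKer (killedMat K A) δ x z) +
              (∑ z ∈ Aᶜ, heatKer K δ x z) * (N * δ ^ 2)) := by
          rw [Finset.sum_add_distrib, Finset.sum_add_distrib, Finset.sum_mul]
      _ ≤ ∑ z ∈ Aᶜ, heatKer (killedMat K A) δ x z * surv K A (N * δ) z +
            (δ ^ 2 + 1 * (N * δ ^ 2)) := by
          gcongr
          exact sum_heatKer_sub_le hK hs h1 hδ hx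
      _ = _ := by push_cast; ring

lemma continuous_surv (hs : ∀ x y, K x y = K y x) (x : V) :
    Continuous fun t => surv K A t x := by
  obtain ⟨μ, v, h⟩ := exists_isSpectralDecomp (killedMat K A) (killedMat_symm hs)
  simp only [surv, h.heatKer_eq]
  fun_prop

end Grid

namespace CTMC

variable {V : Type} [Fintype V] [DecidableEq V] {K : Matrix V V ℝ} (W : CTMC V K) (A : Finset V)

instance : MeasurableSpace W.Ω := W.mΩ

instance (x : V) : IsProbabilityMeasure (W.P x) := W.prob x

/-- The event that the chain is off `A` at the times `0, δ, 2δ, …, N δ`. -/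
def gridAvoid (δ : ℝ) (N : ℕ) : Set W.Ω := {ω | ∀ i : Fin (N + 1), W.X ((i : ℕ) * δ) ω ∉ A}

/-- The event that the chain does not visit `A` during `[0, t]`. -/
def avoid (t : ℝ) : Set W.Ω := {ω | ∀ s, 0 ≤ s → s ≤ t → W.X s ω ∉ A}

/-- The event that the chain never visits `A`. -/
def neverHit : Set W.Ω := {ω | ∀ s, 0 ≤ s → W.X s ω ∉ A}

lemma measurableSet_X_not_mem (t : ℝ) : MeasurableSet {ω | W.X t ω ∉ A} := by
  have : {ω | W.X t ω ∉ A} = ⋃ y ∈ Aᶜ, {ω | W.X t ω = y} := by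
    ext ω
    simp
  rw [this]
  exact Finset.measurableSet_biUnion _ fun y _ => W.measX t y

lemma measurableSet_gridAvoid (δ : ℝ) (N : ℕ) : MeasurableSet (W.gridAvoid A δ N) := by
  simp only [gridAvoid, Set.ofPred_forall]
  exact MeasurableSet.iInter fun i => W.measurableSet_X_not_mem A _

lemma P_gridAvoid (hK : ∀ x y, 0 ≤ K x y) {δ : ℝ} (hδ : 0 ≤ δ) (N : ℕ) (x : V) :
    W.P x (W.gridAvoid A δ N) = ENNReal.ofReal (gridSurv K A δ N x) := by
  have hU : W.gridAvoid A δ N =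
      ⋃ y ∈ Fintype.piFinset fun _ : Fin (N + 1) => Aᶜ,
        {ω | ∀ i : Fin (N + 1), W.X ((i : ℕ) * δ) ω = y i} := by
    ext ω
    simp only [gridAvoid, Set.mem_ofPred_eq, Set.mem_iUnion, Fintype.mem_piFinset,
      Finset.mem_compl, exists_prop]
    refine ⟨fun h => ⟨fun i => W.X (i * δ) ω, h, fun i => rfl⟩, ?_⟩
    rintro ⟨y, hy, h⟩ i
    rw [h i]
    exact hy i
  have hw : ∀ y : Fin (N + 1) → V, 0 ≤ (if y 0 = x then (1 : ℝ) else 0) *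
      ∏ i : Fin N, heatKer K δ (y i.castSucc) (y i.succ) := fun y =>
    mul_nonneg (by positivity) (Finset.prod_nonneg fun i _ => heatKer_nonneg hK hδ _ _)
  rw [hU, measure_biUnion_finset]
  · rw [← sum_paths_eq_gridSurv, ← Finset.sum_subset (Finset.subset_univ
        (Fintype.piFinset fun _ : Fin (N + 1) => Aᶜ)), ENNReal.ofReal_sum_of_nonneg]
    · refine Finset.sum_congr rfl fun y hy => ?_
      have hfdd := W.fdd x N (fun i => ((i : ℕ) : ℝ) * δ)
        (fun i j hij => mul_le_mul_of_nonneg_right (Nat.cast_le.2 (Fin.le_def.1 hij)) hδ)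
        (by simp) y
      rw [hfdd]
      congr 1
      rw [Finset.prod_eq_one (f := fun i => if y i ∈ A then (0 : ℝ) else 1) fun i _ => if_neg
        (Finset.mem_compl.1 (Fintype.mem_piFinset.1 hy i)), mul_one]
      congr 1
      refine Finset.prod_congr rfl fun i _ => ?_
      congr 1
      simp only [Fin.val_succ, Fin.val_castSucc]
      push_cast
      ring
    · intro y _
      exact mul_nonneg (hw y) (Finset.prod_nonneg fun i _ => by positivity)
    · intro y _ hy
      simp only [Fintype.mem_piFinset, Finset.mem_compl, not_forall, not_not] at hy
      obtain ⟨i, hi⟩ := hy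
      rw [Finset.prod_eq_zero (f := fun i => if y i ∈ A then (0 : ℝ) else 1) (Finset.mem_univ i)
        (if_pos hi), mul_zero]
  · intro y _ z _ hyz
    refine Set.disjoint_left.2 fun ω h1 h2 => hyz ?_
    funext i
    exact (h1 i).symm.trans (h2 i)
  · intro y _
    simp only [Set.ofPred_forall]
    exact MeasurableSet.iInter fun i => W.measX _ _

lemma avoid_eq_iInter {t : ℝ} (ht : 0 < t) :
    W.avoid A t = ⋂ m : ℕ, W.gridAvoid A (t / 2 ^ m) (2 ^ m) := by
  ext ω
  simp only [Set.mem_iInter]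
  constructor
  · intro h m i
    refine h _ (by positivity) ?_
    have hi : ((i : ℕ) : ℝ) ≤ 2 ^ m := by exact_mod_cast Nat.lt_succ_iff.1 i.2
    rw [mul_div_assoc', div_le_iff₀ (by positivity), mul_comm]
    gcongr
  · intro h s hs hst hmem
    obtain ⟨ε, hε, hX⟩ := W.rightCts ω s
    obtain ⟨m, hm⟩ := exists_nat_gt (t / ε)
    have hm' : t / 2 ^ m < ε := by
      rw [div_lt_iff₀ (by positivity)]
      rw [div_lt_iff₀ hε] at hm
      have : (m : ℝ) < 2 ^ m := by exact_mod_cast Nat.lt_two_pow_self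
      nlinarith
    set δ := t / 2 ^ m with hδ_def
    have hδ : 0 < δ := by positivity
    have hi : ⌈s / δ⌉₊ < 2 ^ m + 1 := by
      rw [Nat.lt_succ_iff, Nat.ceil_le, div_le_iff₀ hδ, hδ_def]
      push_cast
      rw [mul_div_cancel₀ _ (by positivity)]
      exact hst
    refine h m ⟨_, hi⟩ ?_
    have h1 : s ≤ ⌈s / δ⌉₊ * δ := (div_le_iff₀ hδ).1 (Nat.le_ceil _)
    have h2 : ⌈s / δ⌉₊ * δ < s + δ := by
      have := mul_lt_mul_of_pos_right (Nat.ceil_lt_add_one (by positivity : 0 ≤ s / δ)) hδ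
      rwa [add_mul, div_mul_cancel₀ _ hδ.ne', one_mul] at this
    rw [hX _ h1 (by linarith)]
    exact hmem

lemma measurableSet_avoid {t : ℝ} (ht : 0 ≤ t) : MeasurableSet (W.avoid A t) := by
  rcases ht.eq_or_lt with rfl | ht
  · have : W.avoid A 0 = {ω | W.X 0 ω ∉ A} := by
      ext ω
      refine ⟨fun h => h 0 le_rfl le_rfl, fun h s hs hs' => ?_⟩
      rwa [le_antisymm hs' hs]
    rw [this]
    exact W.measurableSet_X_not_mem A 0
  · rw [W.avoid_eq_iInter A ht]
    exact MeasurableSet.iInter fun m => W.measurableSet_gridAvoid A _ _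

lemma P_avoid (hK : ∀ x y, 0 ≤ K x y) (hs : ∀ x y, K x y = K y x) (h1 : ∀ x, ∑ y, K x y = 1)
    {t : ℝ} (ht : 0 < t) (x : V) : W.P x (W.avoid A t) = ENNReal.ofReal (surv K A t x) := by
  have hanti : Antitone fun m : ℕ => W.gridAvoid A (t / 2 ^ m) (2 ^ m) := by
    refine antitone_nat_of_succ_le fun m ω h i => ?_
    have := h ⟨2 * i, by have := i.2; rw [pow_succ]; omega⟩
    have e : ((2 * (i : ℕ) : ℕ) : ℝ) * (t / 2 ^ (m + 1)) = i * (t / 2 ^ m) := by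
      rw [pow_succ]
      push_cast
      field_simp
    simpa only [e] using this
  have hlim := tendsto_measure_iInter_atTop (μ := W.P x)
    (fun m => (W.measurableSet_gridAvoid A (t / 2 ^ m) (2 ^ m)).nullMeasurableSet) hanti
    ⟨0, measure_ne_top _ _⟩
  rw [← W.avoid_eq_iInter A ht] at hlim
  refine tendsto_nhds_unique hlim ?_
  simp only [Function.comp_def]
  have hN : ∀ m : ℕ, ((2 ^ m : ℕ) : ℝ) * (t / 2 ^ m) = t := fun m => by
    push_cast
    field_simp
  have hsq : ∀ m : ℕ, ((2 ^ m : ℕ) : ℝ) * (t / 2 ^ m) ^ 2 = t ^ 2 * (1 / 2) ^ m := fun m => by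
    push_cast
    rw [one_div, inv_pow]
    field_simp
  have hreal : Tendsto (fun m : ℕ => gridSurv K A (t / 2 ^ m) (2 ^ m) x) atTop
      (nhds (surv K A t x)) := by
    refine tendsto_of_tendsto_of_tendsto_of_le_of_le tendsto_const_nhds
      (h := fun m : ℕ => surv K A t x + t ^ 2 * (1 / 2) ^ m) ?_ (fun m => ?_) (fun m => ?_)
    · simpa using tendsto_const_nhds.add ((tendsto_pow_atTop_nhds_zero_of_lt_one
        (by norm_num : (0 : ℝ) ≤ 1 / 2) (by norm_num)).const_mul (t ^ 2))
    · have := surv_le_gridSurv (A := A) hK hs (by positivity : 0 ≤ t / 2 ^ m) (2 ^ m) x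
      rwa [hN] at this
    · have := gridSurv_le_surv_add (A := A) hK hs h1 (by positivity : 0 ≤ t / 2 ^ m) (2 ^ m) x
      rwa [hN, hsq] at this
  refine (ENNReal.tendsto_ofReal hreal).congr fun m => ?_
  rw [W.P_gridAvoid A hK (by positivity)]

lemma hit_nonneg (ω : W.Ω) : 0 ≤ W.hit A ω := Real.sInf_nonneg fun _ h => h.1

lemma lt_hit_iff {c : ℝ} (hc : 0 ≤ c) (ω : W.Ω) :
    c < W.hit A ω ↔ ω ∈ W.avoid A c \ W.neverHit A := by
  have hbdd : BddBelow {t : ℝ | 0 ≤ t ∧ W.X t ω ∈ (A : Set V)} := ⟨0, fun _ h => h.1⟩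
  constructor
  · intro h
    refine ⟨fun s hs hsc hmem => ?_, fun hnever => ?_⟩
    · exact absurd (csInf_le hbdd ⟨hs, hmem⟩) (not_le.2 (hsc.trans_lt h))
    · have : {t : ℝ | 0 ≤ t ∧ W.X t ω ∈ (A : Set V)} = ∅ :=
        Set.eq_empty_of_forall_notMem fun s hs => hnever s hs.1 hs.2
      rw [hit, this, Real.sInf_empty] at h
      exact absurd h (not_lt.2 hc)
  · rintro ⟨h, hex⟩
    simp only [neverHit, Set.mem_ofPred_eq, not_forall, not_not] at hex
    obtain ⟨s, hs, hmem⟩ := hex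
    obtain ⟨ε, hε, hX⟩ := W.rightCts ω c
    have : c + ε ≤ W.hit A ω := by
      refine le_csInf ⟨s, hs, hmem⟩ fun r hr => ?_
      by_contra hlt
      push Not at hlt
      rcases le_total r c with hrc | hrc
      · exact h r hr.1 hrc hr.2
      · refine h c hc le_rfl ?_
        rw [← hX r hrc hlt]
        exact hr.2
    linarith

lemma neverHit_eq_iInter : W.neverHit A = ⋂ m : ℕ, W.avoid A m := by
  ext ω
  simp only [Set.mem_iInter]
  refine ⟨fun h m s hs _ => h s hs, fun h s hs => ?_⟩
  obtain ⟨m, hm⟩ := exists_nat_ge s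
  exact h m s hs hm

lemma measurableSet_neverHit : MeasurableSet (W.neverHit A) := by
  rw [neverHit_eq_iInter]
  exact MeasurableSet.iInter fun m => W.measurableSet_avoid A m.cast_nonneg

lemma measurable_hit : Measurable (W.hit A) := by
  refine measurable_of_Ioi fun c => ?_
  rcases lt_or_ge c 0 with hc | hc
  · convert! MeasurableSet.univ
    exact Set.eq_univ_of_forall fun ω => hc.trans_le (W.hit_nonneg A ω)
  · have : W.hit A ⁻¹' Set.Ioi c = W.avoid A c \ W.neverHit A :=
      Set.ext fun ω => W.lt_hit_iff A hc ω
    rw [this]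
    exact (W.measurableSet_avoid A hc).diff (W.measurableSet_neverHit A)

variable {A}

lemma _root_.surv_le_exp {r : ℝ} (hK : ∀ x y, 0 ≤ K x y)
    (hup : ∀ t, 0 ≤ t → (Fintype.card V : ℝ)⁻¹ * ∑ x, surv K A t x ≤ Real.exp (-r * t))
    {t : ℝ} (ht : 0 ≤ t) (x : V) : surv K A t x ≤ Fintype.card V * Real.exp (-r * t) := by
  have hne : Nonempty V := ⟨x⟩
  have hn : (0 : ℝ) < Fintype.card V := Nat.cast_pos.2 Fintype.card_pos
  have := hup t ht
  rw [inv_mul_le_iff₀ hn] at this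
  exact (Finset.single_le_sum (f := fun x => surv K A t x) (fun y _ => surv_nonneg hK ht y)
    (Finset.mem_univ x)).trans this

lemma P_neverHit (hK : ∀ x y, 0 ≤ K x y) (hs : ∀ x y, K x y = K y x)
    (h1 : ∀ x, ∑ y, K x y = 1) {r : ℝ} (hr : 0 < r)
    (hup : ∀ t, 0 ≤ t → (Fintype.card V : ℝ)⁻¹ * ∑ x, surv K A t x ≤ Real.exp (-r * t))
    (x : V) : W.P x (W.neverHit A) = 0 := by
  have hlim : Tendsto (fun t : ℝ => ENNReal.ofReal (Fintype.card V * Real.exp (-r * t))) atTop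
      (nhds 0) := by
    rw [← ENNReal.ofReal_zero, ← mul_zero (Fintype.card V : ℝ)]
    refine ENNReal.tendsto_ofReal (Tendsto.const_mul _ ?_)
    exact Real.tendsto_exp_atBot.comp (tendsto_id.const_mul_atTop_of_neg (neg_lt_zero.2 hr))
  refine le_antisymm (ge_of_tendsto hlim ?_) bot_le
  filter_upwards [eventually_gt_atTop 0] with t ht
  calc W.P x (W.neverHit A) ≤ W.P x (W.avoid A t) := measure_mono fun ω h s hs _ => h s hs
    _ ≤ _ := by
      rw [W.P_avoid A hK hs h1 ht]
      exact ENNReal.ofReal_le_ofReal (surv_le_exp hK hup ht.le x)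

lemma P_lt_hit (hK : ∀ x y, 0 ≤ K x y) (hs : ∀ x y, K x y = K y x)
    (h1 : ∀ x, ∑ y, K x y = 1) {r : ℝ} (hr : 0 < r)
    (hup : ∀ t, 0 ≤ t → (Fintype.card V : ℝ)⁻¹ * ∑ x, surv K A t x ≤ Real.exp (-r * t))
    {t : ℝ} (ht : 0 < t) (x : V) :
    W.P x {ω | t < W.hit A ω} = ENNReal.ofReal (surv K A t x) := by
  have : {ω | t < W.hit A ω} = W.avoid A t \ W.neverHit A :=
    Set.ext fun ω => W.lt_hit_iff A ht.le ω
  rw [this, measure_sdiff_null (W.P_neverHit hK hs h1 hr hup x), W.P_avoid A hK hs h1 ht]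

lemma prpi_hit_le (hK : ∀ x y, 0 ≤ K x y) (hs : ∀ x y, K x y = K y x)
    (h1 : ∀ x, ∑ y, K x y = 1) [Nonempty V] {r : ℝ} (hr : 0 < r)
    (hup : ∀ t, 0 ≤ t → (Fintype.card V : ℝ)⁻¹ * ∑ x, surv K A t x ≤ Real.exp (-r * t))
    {t : ℝ} (ht : 0 < t) :
    W.prpi {ω | W.hit A ω ≤ t} = 1 - (Fintype.card V : ℝ)⁻¹ * ∑ x, surv K A t x := by
  have hx : ∀ x, W.prx x {ω | W.hit A ω ≤ t} = 1 - surv K A t x := by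
    intro x
    have hc : {ω | W.hit A ω ≤ t} = {ω | t < W.hit A ω}ᶜ := by
      ext ω
      simp
    rw [prx, hc, ← measureReal_def, probReal_compl_eq_one_sub
      (measurableSet_lt measurable_const (W.measurable_hit A)), measureReal_def,
      W.P_lt_hit hK hs h1 hr hup ht, ENNReal.toReal_ofReal (surv_nonneg hK ht.le x)]
  simp only [prpi, hx, Finset.sum_sub_distrib, Finset.sum_const, Finset.card_univ, nsmul_eq_mul]
  field_simp

lemma integrableOn_surv (hK : ∀ x y, 0 ≤ K x y) (hs : ∀ x y, K x y = K y x) {r : ℝ} (hr : 0 < r)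
    (hup : ∀ t, 0 ≤ t → (Fintype.card V : ℝ)⁻¹ * ∑ x, surv K A t x ≤ Real.exp (-r * t))
    (x : V) : IntegrableOn (fun t => surv K A t x) (Set.Ioi 0) := by
  refine Integrable.mono' ((integrableOn_exp_mul_Ioi (neg_lt_zero.2 hr) 0).const_mul
    (Fintype.card V : ℝ)) (continuous_surv hs x).aestronglyMeasurable ?_
  filter_upwards [ae_restrict_mem measurableSet_Ioi] with t ht
  rw [Real.norm_of_nonneg (surv_nonneg hK (le_of_lt ht) x)]
  exact surv_le_exp hK hup (le_of_lt ht) x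

lemma integral_hit (hK : ∀ x y, 0 ≤ K x y) (hs : ∀ x y, K x y = K y x)
    (h1 : ∀ x, ∑ y, K x y = 1) {r : ℝ} (hr : 0 < r)
    (hup : ∀ t, 0 ≤ t → (Fintype.card V : ℝ)⁻¹ * ∑ x, surv K A t x ≤ Real.exp (-r * t))
    (x : V) : W.ex x (W.hit A) = ∫ t in Set.Ioi 0, surv K A t x := by
  have hnn : 0 ≤ᵐ[W.P x] W.hit A := Eventually.of_forall (W.hit_nonneg A)
  have hint : Integrable (W.hit A) (W.P x) := by
    refine ⟨(W.measurable_hit A).aestronglyMeasurable, ?_⟩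
    rw [hasFiniteIntegral_iff_ofReal hnn,
      lintegral_eq_lintegral_meas_lt _ hnn (W.measurable_hit A).aemeasurable,
      setLIntegral_congr_fun measurableSet_Ioi fun t ht => W.P_lt_hit hK hs h1 hr hup ht x]
    exact (integrableOn_surv hK hs hr hup x).lintegral_lt_top
  rw [ex, hint.integral_eq_integral_meas_lt hnn]
  refine setIntegral_congr_fun measurableSet_Ioi fun t ht => ?_
  simp only [measureReal_def]
  rw [W.P_lt_hit hK hs h1 hr hup ht, ENNReal.toReal_ofReal (surv_nonneg hK (le_of_lt ht) x)]

lemma epi_hit_nonneg : 0 ≤ W.epi (W.hit A) :=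
  mul_nonneg (by positivity) (Finset.sum_nonneg fun _ _ => integral_nonneg (W.hit_nonneg A))

/-- The stationary mean hitting time is within `τ` of the inverse rate `1 / r`. -/
lemma epi_hit_mem_Icc (hK : ∀ x y, 0 ≤ K x y) (hs : ∀ x y, K x y = K y x)
    (h1 : ∀ x, ∑ y, K x y = 1) {r τ : ℝ} (hr : 0 < r)
    (hlow : ∀ t, 0 ≤ t →
      (1 - r * τ) * Real.exp (-r * t) ≤ (Fintype.card V : ℝ)⁻¹ * ∑ x, surv K A t x)
    (hup : ∀ t, 0 ≤ t → (Fintype.card V : ℝ)⁻¹ * ∑ x, surv K A t x ≤ Real.exp (-r * t)) :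
    W.epi (W.hit A) ∈ Set.Icc (1 / r - τ) (1 / r) := by
  have hexp : ∫ t in Set.Ioi (0 : ℝ), Real.exp (-r * t) = 1 / r := by
    rw [integral_exp_mul_Ioi (neg_lt_zero.2 hr)]
    simp
  have hei := integrableOn_exp_mul_Ioi (neg_lt_zero.2 hr) 0
  have hE : W.epi (W.hit A) =
      ∫ t in Set.Ioi (0 : ℝ), (Fintype.card V : ℝ)⁻¹ * ∑ x, surv K A t x := by
    simp only [epi, W.integral_hit hK hs h1 hr hup]
    rw [integral_const_mul, integral_finsetSum]
    exact fun x _ => integrableOn_surv hK hs hr hup x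
  have hgi : IntegrableOn (fun t => (Fintype.card V : ℝ)⁻¹ * ∑ x, surv K A t x) (Set.Ioi 0) :=
    (integrable_finsetSum _ fun x _ => integrableOn_surv hK hs hr hup x).const_mul _
  rw [hE]
  constructor
  · calc 1 / r - τ = ∫ t in Set.Ioi (0 : ℝ), (1 - r * τ) * Real.exp (-r * t) := by
          rw [integral_const_mul, hexp]
          field_simp
      _ ≤ _ := setIntegral_mono_on (hei.const_mul _) hgi measurableSet_Ioi
          fun t ht => hlow t (le_of_lt ht)
  · rw [← hexp]
    exact setIntegral_mono_on hgi hei measurableSet_Ioi fun t ht => hup t (le_of_lt ht)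

end CTMC

/-- The linear approximation error, from two-sided exponential bounds on the tail `1 - p` of the
hitting time at time `t` and on its mean `E`. -/
lemma abs_mean_mul_prob_sub_le {r τ t p E : ℝ} (hr : 0 < r) (hτ : 0 ≤ τ) (ht : 0 < t)
    (hrt : r * t ≤ 1) (hE0 : 0 ≤ E) (hE : E ∈ Set.Icc (1 / r - τ) (1 / r))
    (hlow : (1 - r * τ) * Real.exp (-r * t) ≤ 1 - p) (hup : 1 - p ≤ Real.exp (-r * t)) :
    |E * p - t| ≤ τ + r * t ^ 2 := by
  have he1 : Real.exp (-r * t) ≤ 1 := Real.exp_le_one_iff.2 (by nlinarith)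
  have he2 : 1 - r * t ≤ Real.exp (-r * t) := by linarith [Real.add_one_le_exp (-r * t)]
  have he3 : Real.exp (-r * t) ≤ 1 - r * t + (r * t) ^ 2 := by
    have hrt0 : 0 < r * t := by positivity
    have := (abs_le.1 (Real.abs_exp_sub_one_sub_id_le (x := -r * t)
      (by rw [neg_mul, abs_neg, abs_of_pos hrt0]; exact hrt))).2
    nlinarith
  have hq0 : 0 ≤ r * t - (r * t) ^ 2 := by nlinarith [mul_pos hr ht]
  have hp : r * t - (r * t) ^ 2 ≤ p := by linarith
  have hrτ : r * τ * Real.exp (-r * t) ≤ r * τ := mul_le_of_le_one_right (by positivity) he1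
  have hp' : p ≤ r * t + r * τ := by linarith
  have hp0 : 0 ≤ p := hq0.trans hp
  rw [abs_le]
  constructor
  · rcases le_total (1 / r - τ) 0 with hneg | hpos
    · have h2 : 1 / r ≤ τ := by linarith
      have h3 : t ≤ 1 / r := (le_div_iff₀ hr).2 (by linarith)
      nlinarith [mul_nonneg hE0 hp0, mul_nonneg hr.le (sq_nonneg t)]
    · have h2 : (1 / r - τ) * (r * t - (r * t) ^ 2) ≤ E * p :=
        mul_le_mul hE.1 hp hq0 (hpos.trans hE.1)
      have h3 : (1 / r - τ) * (r * t - (r * t) ^ 2) =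
          t - r * t ^ 2 - τ * (r * t) + τ * (r * t) ^ 2 := by
        field_simp
        ring
      nlinarith [mul_nonneg hτ (sq_nonneg (r * t)), mul_le_mul_of_nonneg_left hrt hτ]
  · have h2 : E * p ≤ 1 / r * (r * t + r * τ) := mul_le_mul hE.2 hp' hp0 (by positivity)
    have h3 : 1 / r * (r * t + r * τ) = t + τ := by field_simp
    nlinarith [mul_nonneg hr.le (sq_nonneg t)]

/-- Proposition 2.10: for `t = t(n) ≪ n`, uniformly over sets `A` of
cardinality `k` and over such time sequences,
`E_π(T_A) = (t / P_π(T_A ≤ t)) (1 + O(n/(t f(n))) + O(t/n))`. -/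
theorem linear_approximation_of_hitting
    (B : ℕ → GW) (d : ℕ) (hB : GoodSeq B d) (k : ℕ) (hk1 : 1 ≤ k) :
    ∃ C : ℝ, 0 < C ∧ ∀ t : ℕ → ℝ, (∀ n, 0 < t n) →
      Tendsto (fun n => t n / ((B n).nV : ℝ)) atTop (nhds 0) →
      ∃ N : ℕ, ∀ n ≥ N, ∀ A : Finset (B n).V, A.card = k →
        |(B n).W.epi ((B n).W.hit ↑A) -
            t n / (B n).W.prpi {ω | (B n).W.hit (↑A) ω ≤ t n}| ≤
          (t n / (B n).W.prpi {ω | (B n).W.hit (↑A) ω ≤ t n}) *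
            (C * (((B n).nV : ℝ) / (t n * (B n).fgrowth) + t n / ((B n).nV : ℝ))) := by
  refine ⟨d + 2 * k + 1, by positivity, fun t ht hlim => ?_⟩
  obtain ⟨hconn, htrans, hdeg, hsize, -⟩ := hB
  have hk0 : (0 : ℝ) < k := Nat.cast_pos.2 hk1
  obtain ⟨N, hN⟩ := eventually_atTop.1 ((hsize.eventually_gt_atTop (2 * k)).and
    (hlim.eventually_lt_const (by positivity : (0 : ℝ) < 1 / (2 * k))))
  refine ⟨N, fun n hn A hA => ?_⟩
  obtain ⟨hnV, htn⟩ := hN n hn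
  have hcard : 2 * A.card < Fintype.card (B n).V := by rw [hA]; exact hnV
  have : Nontrivial (B n).V := Fintype.one_lt_card_iff_nontrivial.1 (by omega)
  have hpos : ∀ x, 0 < (B n).G.degree x := fun x =>
    (hconn n).preconnected.degree_pos_of_nontrivial x
  have hK := transMat_nonneg (G := (B n).G)
  have hs := transMat_symm (htrans n)
  have h1 := fun x => transMat_row_sum x (hpos x)
  have hτ : 0 ≤ (d : ℝ) * (gDiam (B n).G : ℝ) ^ 2 := by positivity
  obtain ⟨r, hr, hrn, hr'⟩ := exists_rate (A := A) hK hs h1 hτ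
    (variance_le_gDiam_sq (hconn n) (htrans n) (hdeg n) hpos) (by omega) hcard
  have hup := fun s hs => (hr' s hs).2
  have hnV0 : (0 : ℝ) < (B n).nV := Nat.cast_pos.2 (by omega)
  replace hrn : r ≤ 2 * k / (B n).nV := by rw [← hA]; exact hrn
  have htn' : 2 * k * t n ≤ (B n).nV := by
    rw [div_lt_div_iff₀ hnV0 (by positivity)] at htn
    linarith
  have hrt : r * t n ≤ 1 := by
    calc r * t n ≤ 2 * k / (B n).nV * t n := mul_le_mul_of_nonneg_right hrn (ht n).le
      _ = 2 * k * t n / (B n).nV := by ring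
      _ ≤ 1 := (div_le_one hnV0).2 htn'
  have hp := (B n).W.prpi_hit_le hK hs h1 hr hup (ht n)
  set p := (B n).W.prpi {ω | (B n).W.hit (↑A) ω ≤ t n}
  have hp0 : 0 < p := by
    have := hup (t n) (ht n).le
    have : Real.exp (-r * t n) < 1 := Real.exp_lt_one_iff.2 (by nlinarith [mul_pos hr (ht n)])
    linarith
  have hmain := abs_mean_mul_prob_sub_le (p := p) hr hτ (ht n) hrt (B n).W.epi_hit_nonneg
    ((B n).W.epi_hit_mem_Icc hK hs h1 hr (fun s hs => (hr' s hs).1) hup)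
    (by rw [hp, sub_sub_cancel]; exact (hr' (t n) (ht n).le).1)
    (by rw [hp, sub_sub_cancel]; exact hup (t n) (ht n).le)
  have hf : ((B n).nV : ℝ) / (t n * (B n).fgrowth) = (gDiam (B n).G : ℝ) ^ 2 / t n := by
    rw [GW.fgrowth, GW.D]
    field_simp
  set E := (B n).W.epi ((B n).W.hit ↑A)
  have hE : |E - t n / p| = |E * p - t n| / p := by
    rw [← abs_of_pos hp0, ← abs_div, abs_of_pos hp0]
    congr 1
    field_simp
  have hR : t n / p * ((d + 2 * k + 1) * ((gDiam (B n).G : ℝ) ^ 2 / t n + t n / (B n).nV)) =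
      (d + 2 * k + 1) * ((gDiam (B n).G : ℝ) ^ 2 + t n ^ 2 / (B n).nV) / p := by
    have := (ht n).ne'
    field_simp
  rw [hf, hE, hR]
  gcongr
  refine hmain.trans ?_
  have h2 : r * t n ^ 2 ≤ 2 * k * (t n ^ 2 / (B n).nV) := by
    calc r * t n ^ 2 ≤ 2 * k / (B n).nV * t n ^ 2 := by gcongr
      _ = _ := by ring
  have h3 : 0 ≤ t n ^ 2 / (B n).nV := by positivity
  have h4 : 0 ≤ (gDiam (B n).G : ℝ) ^ 2 := by positivity
  nlinarith [mul_nonneg hk0.le h4, mul_nonneg (Nat.cast_nonneg (α := ℝ) d) h3]
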